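/- Let A=(S,Act,→) be a labelled transition system and K_A its embedding Kripke structure. Then for all states s,t ∈ S, s and t are branching bisimilar in A if and only if s and t are divergence-blind stuttering equivalent in K_A. -/

import Mathlib

/-- A labelled transition system. -/
structure LTS (S Act : Type*) where
  tr : S → Act → S → Prop

variable {S Act : Type*}

/-- `R` is a branching bisimulation relation on the LTS `A` with internal action `τ`. -/
def IsBranchingBisim (A : LTS S Act) (τ : Act) (R : S → S → Prop) : Prop :=
  Symmetric R ∧ ∀ s t, R s t → ∀ a s', A.tr s a s' →
    ((a = τ ∧ R s' t) ∨
     ∃ (k : ℕ) (f : ℕ → S), f 0 = t ∧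
       (∀ i < k, A.tr (f i) τ (f (i + 1))) ∧
       R s (f k) ∧ ∃ t'', A.tr (f k) a t'' ∧ R s' t'')

/-- Branching bisimilarity of two states. -/
def BranchingBisimilar (A : LTS S Act) (τ : Act) (s t : S) : Prop :=
  ∃ R, IsBranchingBisim A τ R ∧ R s t

/-- The transition relation of the embedding Kripke structure `K_A`:
`s →' ⟨a,t⟩` whenever `s →a t` with `a ≠ τ`, `⟨a,t⟩ →' t` for every such pair,
and `s →' t` whenever `s →τ t`. -/
def embedTr (A : LTS S Act) (τ : Act) : (S ⊕ Act × S) → (S ⊕ Act × S) → Prop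
  | Sum.inl s, Sum.inr (a, t) => A.tr s a t ∧ a ≠ τ
  | Sum.inr (a, t), Sum.inl t' => t' = t ∧ a ≠ τ ∧ ∃ s, A.tr s a t
  | Sum.inl s, Sum.inl t => A.tr s τ t
  | _, _ => False

/-- The labelling of the embedding Kripke structure, where `none` plays the
role of the fresh symbol `⊥` and `some a` of the action `a`. -/
def embedL : (S ⊕ Act × S) → Set (Option Act)
  | Sum.inl _ => {none}
  | Sum.inr (a, _) => {some a}

/-- `R` is a divergence-blind stuttering equivalence for a Kripke structure
given by a transition relation `tr` and a labelling `L`. -/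
def IsDBS {St AP : Type*} (tr : St → St → Prop) (L : St → Set AP)
    (R : St → St → Prop) : Prop :=
  Symmetric R ∧ ∀ s t, R s t →
    L s = L t ∧
    ∀ s', tr s s' → ∃ (k : ℕ) (f : ℕ → St), f 0 = t ∧
      (∀ i < k, tr (f i) (f (i + 1))) ∧
      (∀ i < k, R s (f i)) ∧ R s' (f k)

/-- Divergence-blind stuttering equivalence of two states. -/
def DBSEq {St AP : Type*} (tr : St → St → Prop) (L : St → Set AP)
    (s t : St) : Prop :=
  ∃ R, IsDBS tr L R ∧ R s t

open Relation

theorem exists_path_iff_reflTransGen {α : Type*} {r : α → α → Prop} {a b : α} :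
    (∃ (k : ℕ) (f : ℕ → α), f 0 = a ∧ (∀ i < k, r (f i) (f (i + 1))) ∧ f k = b) ↔
      ReflTransGen r a b := by
  constructor
  · rintro ⟨k, f, rfl, hf, rfl⟩
    induction k with
    | zero => exact .refl
    | succ k ih => exact (ih fun i hi => hf i (by omega)).tail (hf k (by omega))
  · intro h
    induction h using ReflTransGen.head_induction_on with
    | refl => exact ⟨0, fun _ => b, rfl, by simp, rfl⟩
    | @head a c hac _ ih =>
      obtain ⟨k, f, h0, hf, hk⟩ := ih
      refine ⟨k + 1, fun n => Nat.casesOn n a f, rfl, fun i hi => ?_, hk⟩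
      cases i with
      | zero => simpa [h0] using hac
      | succ i => exact hf i (by omega)

theorem isBranchingBisim_iff {A : LTS S Act} {τ : Act} {R : S → S → Prop} :
    IsBranchingBisim A τ R ↔ Symmetric R ∧ ∀ s t, R s t → ∀ a s', A.tr s a s' →
      ((a = τ ∧ R s' t) ∨ ∃ t', ReflTransGen (A.tr · τ ·) t t' ∧ R s t' ∧
        ∃ t'', A.tr t' a t'' ∧ R s' t'') := by
  simp only [IsBranchingBisim, ← exists_path_iff_reflTransGen]
  refine and_congr_right fun _ => forall₃_congr fun s t _ => forall₃_congr fun a s' _ =>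
    or_congr_right ⟨?_, ?_⟩
  · rintro ⟨k, f, h0, hf, h⟩
    exact ⟨f k, ⟨k, f, h0, hf, rfl⟩, h⟩
  · rintro ⟨_, ⟨k, f, h0, hf, rfl⟩, h⟩
    exact ⟨k, f, h0, hf, h⟩

theorem isDBS_iff {St AP : Type*} {tr : St → St → Prop} {L : St → Set AP}
    {R : St → St → Prop} :
    IsDBS tr L R ↔ Symmetric R ∧ ∀ s t, R s t → L s = L t ∧ ∀ s', tr s s' →
      ∃ t', ReflTransGen (fun x y => R s x ∧ tr x y) t t' ∧ R s' t' := by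
  simp only [IsDBS, ← exists_path_iff_reflTransGen]
  refine and_congr_right fun _ => forall₃_congr fun s t _ => and_congr_right fun _ =>
    forall₂_congr fun s' _ => ⟨?_, ?_⟩
  · rintro ⟨k, f, h0, hf, hR, h⟩
    exact ⟨f k, ⟨k, f, h0, fun i hi => ⟨hR i hi, hf i hi⟩, rfl⟩, h⟩
  · rintro ⟨_, ⟨k, f, h0, hf, rfl⟩, h⟩
    exact ⟨k, f, h0, fun i hi => (hf i hi).2, fun i hi => (hf i hi).1, h⟩

theorem isBranchingBisim_branchingBisimilar (A : LTS S Act) (τ : Act) :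
    IsBranchingBisim A τ (BranchingBisimilar A τ) := by
  rw [isBranchingBisim_iff]
  refine ⟨fun s t ⟨R, hR, h⟩ => ⟨R, hR, hR.1 h⟩, ?_⟩
  rintro s t ⟨R, hR, h⟩ a s' hs
  rcases (isBranchingBisim_iff.1 hR).2 s t h a s' hs with
    ⟨ha, h'⟩ | ⟨t', ht, h₁, t'', htr, h₂⟩
  · exact .inl ⟨ha, R, hR, h'⟩
  · exact .inr ⟨t', ht, ⟨R, hR, h₁⟩, t'', htr, R, hR, h₂⟩

theorem IsBranchingBisim.exists_reflTransGen {A : LTS S Act} {τ : Act} {R : S → S → Prop}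
    (hR : IsBranchingBisim A τ R) {s s' t : S} (h : R s t)
    (hs : ReflTransGen (A.tr · τ ·) s s') :
    ∃ t', ReflTransGen (A.tr · τ ·) t t' ∧ R s' t' := by
  induction hs with
  | refl => exact ⟨t, .refl, h⟩
  | tail _ hstep ih =>
    obtain ⟨t₁, ht₁, h₁⟩ := ih
    rcases (isBranchingBisim_iff.1 hR).2 _ _ h₁ _ _ hstep with
      ⟨-, h₂⟩ | ⟨t₂, ht₂, -, t₃, htr, h₃⟩
    · exact ⟨t₁, ht₁, h₂⟩
    · exact ⟨t₃, (ht₁.trans ht₂).tail htr, h₃⟩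

/-- Relating states that can each silently reach a partner of the other preserves
branching bisimulations. -/
theorem IsBranchingBisim.stuttering_closure {A : LTS S Act} {τ : Act} {R : S → S → Prop}
    (hR : IsBranchingBisim A τ R) :
    IsBranchingBisim A τ fun s t =>
      (∃ t', ReflTransGen (A.tr · τ ·) t t' ∧ R s t') ∧
        ∃ s', ReflTransGen (A.tr · τ ·) s s' ∧ R t s' := by
  have of_rel {s t : S} (h : R s t) : (∃ t', ReflTransGen (A.tr · τ ·) t t' ∧ R s t') ∧
      ∃ s', ReflTransGen (A.tr · τ ·) s s' ∧ R t s' :=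
    ⟨⟨t, .refl, h⟩, s, .refl, hR.1 h⟩
  rw [isBranchingBisim_iff]
  refine ⟨fun s t h => h.symm, ?_⟩
  rintro s t ⟨⟨t₁, ht₁, hst₁⟩, s₁, hs₁, hts₁⟩ a s' hs
  rcases (isBranchingBisim_iff.1 hR).2 _ _ hst₁ _ _ hs with
    ⟨rfl, h'⟩ | ⟨t₂, ht₂, h₂, t₃, htr, h₃⟩
  · rcases ht₁.cases_tail with rfl | ⟨p, htp, hp⟩
    · exact .inl ⟨rfl, of_rel h'⟩
    · obtain ⟨s₂, hs₂, hps₂⟩ := hR.exists_reflTransGen hts₁ htp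
      exact .inr ⟨p, htp, ⟨⟨t₁, .single hp, hst₁⟩, s₂, hs₁.trans hs₂, hps₂⟩, t₁, hp, of_rel h'⟩
  · exact .inr ⟨t₂, ht₁.trans ht₂, of_rel h₂, t₃, htr, of_rel h₃⟩

/-- The stuttering lemma: a silent path between two states bisimilar to `s` stays within the
states bisimilar to `s`. -/
theorem BranchingBisimilar.reflTransGen_of_reflTransGen {A : LTS S Act} {τ : Act} {s t t' : S}
    (h : BranchingBisimilar A τ s t) (h' : BranchingBisimilar A τ s t')
    (ht : ReflTransGen (A.tr · τ ·) t t') :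
    ReflTransGen (fun x y => BranchingBisimilar A τ s x ∧ A.tr x τ y) t t' := by
  have hB := isBranchingBisim_branchingBisimilar A τ
  induction ht using ReflTransGen.head_induction_on with
  | refl => exact .refl
  | head hac hcb ih =>
    obtain ⟨s₁, hs₁, hcs₁⟩ := hB.exists_reflTransGen (hB.1 h) (.single hac)
    exact (ih ⟨_, hB.stuttering_closure, ⟨t', hcb, h'⟩, s₁, hs₁, hcs₁⟩).head ⟨h, hac⟩

/-- The lifting of a relation on an LTS to its embedding, where an action state is only related
to others if it is the target of a transition. -/
inductive EmbedRel (A : LTS S Act) (τ : Act) (R : S → S → Prop) :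
    S ⊕ Act × S → S ⊕ Act × S → Prop
  | state {s t : S} (h : R s t) : EmbedRel A τ R (Sum.inl s) (Sum.inl t)
  | action {a : Act} {s t : S} (ha : a ≠ τ) (hs : ∃ p, A.tr p a s) (ht : ∃ p, A.tr p a t)
      (h : R s t) : EmbedRel A τ R (Sum.inr (a, s)) (Sum.inr (a, t))

theorem isDBS_embedRel (A : LTS S Act) (τ : Act) :
    IsDBS (embedTr A τ) embedL (EmbedRel A τ (BranchingBisimilar A τ)) := by
  have hB := isBranchingBisim_branchingBisimilar A τ
  have lift {s t t' : S} (h : BranchingBisimilar A τ s t) (h' : BranchingBisimilar A τ s t')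
      (ht : ReflTransGen (A.tr · τ ·) t t') :
      ReflTransGen (fun x y => EmbedRel A τ (BranchingBisimilar A τ) (Sum.inl s) x ∧
        embedTr A τ x y) (Sum.inl t) (Sum.inl t') :=
    (h.reflTransGen_of_reflTransGen h' ht).lift Sum.inl fun _ _ hxy => ⟨.state hxy.1, hxy.2⟩
  rw [isDBS_iff]
  constructor
  · rintro _ _ (h | ⟨ha, hs, ht, h⟩)
    · exact .state (hB.1 h)
    · exact .action ha ht hs (hB.1 h)
  rintro _ _ (@⟨s, t, h⟩ | @⟨a, s, t, ha, hs, ht, h⟩)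
  · refine ⟨rfl, ?_⟩
    rintro (s' | ⟨a, s'⟩) hstep
    · rcases (isBranchingBisim_iff.1 hB).2 _ _ h τ s' hstep with
        ⟨-, h'⟩ | ⟨t₁, ht₁, h₁, t₂, htr, h₂⟩
      · exact ⟨_, .refl, .state h'⟩
      · exact ⟨Sum.inl t₂, (lift h h₁ ht₁).tail ⟨.state h₁, htr⟩, .state h₂⟩
    · obtain ⟨hstep, ha⟩ := hstep
      rcases (isBranchingBisim_iff.1 hB).2 _ _ h a s' hstep with
        ⟨ha', -⟩ | ⟨t₁, ht₁, h₁, t₂, htr, h₂⟩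
      · exact absurd ha' ha
      · exact ⟨Sum.inr (a, t₂), (lift h h₁ ht₁).tail ⟨.state h₁, htr, ha⟩,
          .action ha ⟨_, hstep⟩ ⟨_, htr⟩ h₂⟩
  · refine ⟨rfl, ?_⟩
    rintro (s' | ⟨b, s'⟩) hstep
    · obtain ⟨rfl, -, -⟩ := hstep
      exact ⟨Sum.inl t, .single ⟨.action ha hs ht h, rfl, ha, ht⟩, .state h⟩
    · exact hstep.elim

theorem embedL_inl_ne_inr (s : S) (p : Act × S) :
    embedL (Sum.inl s : S ⊕ Act × S) ≠ embedL (Sum.inr p) := by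
  simp [embedL]

theorem IsDBS.reflTransGen_of_reflTransGen_inl {A : LTS S Act} {τ : Act}
    {R : S ⊕ Act × S → S ⊕ Act × S → Prop} (hR : IsDBS (embedTr A τ) embedL R) {s t t' : S}
    (h : ReflTransGen (fun x y => R (Sum.inl s) x ∧ embedTr A τ x y) (Sum.inl t) (Sum.inl t')) :
    ReflTransGen (A.tr · τ ·) t t' := by
  generalize hx : (Sum.inl t' : S ⊕ Act × S) = x at h
  induction h generalizing t' with
  | refl => cases hx; exact .refl
  | @tail y _ _ hstep ih =>
    subst hx
    rcases y with y | y
    · exact (ih rfl).tail hstep.2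
    · exact absurd (hR.2 _ _ hstep.1).1 (embedL_inl_ne_inr s y)

theorem IsDBS.rel_inl_of_rel_inr {A : LTS S Act} {τ : Act}
    {R : S ⊕ Act × S → S ⊕ Act × S → Prop} (hR : IsDBS (embedTr A τ) embedL R) {a : Act}
    {s t : S} (ha : a ≠ τ) (hs : ∃ p, A.tr p a s) (h : R (Sum.inr (a, s)) (Sum.inr (a, t))) :
    R (Sum.inl s) (Sum.inl t) := by
  obtain ⟨x, hx, hsx⟩ := ((isDBS_iff.1 hR).2 _ _ h).2 (Sum.inl s) ⟨rfl, ha, hs⟩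
  rcases x with x | x
  · rcases hx.cases_tail with hx | ⟨y | ⟨b, y⟩, hy, hRy, hstep⟩
    · cases hx
    · exact absurd (hR.2 _ _ hRy).1.symm (embedL_inl_ne_inr y _)
    · rcases hy.cases_tail with hy | ⟨z | z, -, hRz, hzy⟩
      · cases hy
        obtain ⟨rfl, -⟩ := hstep
        exact hsx
      · exact absurd (hR.2 _ _ hRz).1.symm (embedL_inl_ne_inr z _)
      · exact hzy.elim
  · exact absurd (hR.2 _ _ hsx).1 (embedL_inl_ne_inr s x)

theorem IsDBS.isBranchingBisim {A : LTS S Act} {τ : Act}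
    {R : S ⊕ Act × S → S ⊕ Act × S → Prop} (hR : IsDBS (embedTr A τ) embedL R) :
    IsBranchingBisim A τ fun s t => R (Sum.inl s) (Sum.inl t) := by
  rw [isBranchingBisim_iff]
  refine ⟨fun s t h => hR.1 h, fun s t h a s' hs => ?_⟩
  by_cases ha : a = τ
  · subst ha
    obtain ⟨x | x, hx, hsx⟩ := ((isDBS_iff.1 hR).2 _ _ h).2 (Sum.inl s') hs
    · rcases hx.cases_tail with hx | ⟨y | y, hy, hRy, hstep⟩
      · cases hx
        exact .inl ⟨rfl, hsx⟩
      · exact .inr ⟨y, hR.reflTransGen_of_reflTransGen_inl hy, hRy, x, hstep, hsx⟩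
      · exact absurd (hR.2 _ _ hRy).1 (embedL_inl_ne_inr s y)
    · exact absurd (hR.2 _ _ hsx).1 (embedL_inl_ne_inr s' x)
  · obtain ⟨x | ⟨b, x⟩, hx, hsx⟩ := ((isDBS_iff.1 hR).2 _ _ h).2 (Sum.inr (a, s')) ⟨hs, ha⟩
    · exact absurd (hR.2 _ _ hsx).1.symm (embedL_inl_ne_inr x _)
    · obtain rfl : a = b := by simpa [embedL] using (hR.2 _ _ hsx).1
      rcases hx.cases_tail with hx | ⟨y | y, hy, hRy, hstep⟩
      · cases hx
      · exact .inr ⟨y, hR.reflTransGen_of_reflTransGen_inl hy, hRy, x, hstep.1,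
          hR.rel_inl_of_rel_inr ha ⟨s, hs⟩ hsx⟩
      · exact absurd (hR.2 _ _ hRy).1 (embedL_inl_ne_inr s y)

/-- Two states of an LTS are branching bisimilar iff they are divergence-blind
stuttering equivalent in the embedding Kripke structure. -/
theorem branching_bisim_iff_dbs_in_embedding [Fintype S] [Fintype Act]
    (A : LTS S Act) (τ : Act) (s t : S) :
    BranchingBisimilar A τ s t ↔
      DBSEq (embedTr A τ) embedL (Sum.inl s) (Sum.inl t) := by
  constructor
  · exact fun h => ⟨_, isDBS_embedRel A τ, .state h⟩
  · rintro ⟨R, hR, h⟩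
    exact ⟨_, hR.isBranchingBisim, h⟩
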